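/- Let X = ⋃_{n≥1} f̃_n^{-1}{1} \ ⋃_{n≥1} f̃_n^{-1}{0}. If Π_{j=1}^∞ p_j = 0, then X is contained in the residual spectrum of the transition operator S acting on l^1. If Π_{j=1}^∞ p_j > 0, then the residual spectrum of S on l^1 is disjoint from ⋃_{n≥1} f̃_n^{-1}{1}. -/

import Mathlib

open Filter Finset
open scoped ENNReal Topology ZeroAtInfty

noncomputable section

namespace AMFC

/-- `q d j = d 0 * d 1 * ... * d j`. -/
def q (d : ℕ → ℕ) (j : ℕ) : ℕ := ∏ i ∈ Finset.range (j + 1), d i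

/-- For `j ≥ 1`, `digit d n j = ⌊n / q_{j-1}⌋ mod d_j` is the `j`-th digit of `n`
in the Cantor system of numeration. -/
def digit (d : ℕ → ℕ) (n j : ℕ) : ℕ := (n / q d (j - 1)) % d j

/-- The counter `ζ_n = min { j ≥ 1 : a_j(n) ≠ d_j - 1 }`. -/
def zeta (d : ℕ → ℕ) (n : ℕ) : ℕ := sInf {j | 1 ≤ j ∧ digit d n j ≠ d j - 1}

open scoped Classical in
/-- The transition probabilities of the stochastic adding machine. -/
def s (d : ℕ → ℕ) (p : ℕ → ℝ) (n m : ℕ) : ℝ :=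
  if m = n + 1 then ∏ j ∈ Finset.Icc 1 (zeta d n), p j
  else if m = n then 1 - p 1
  else if h : ∃ r, 1 ≤ r ∧ r + 1 ≤ zeta d n ∧
      n = m + ∑ j ∈ Finset.Icc 1 r, (d j - 1) * q d (j - 1)
    then (1 - p (h.choose + 1)) * ∏ j ∈ Finset.Icc 1 h.choose, p j
  else 0

/-- `f j (z) = ((z - (1 - p j)) / p j) ^ (d j)`. -/
def f (d : ℕ → ℕ) (p : ℕ → ℝ) (j : ℕ) (z : ℂ) : ℂ :=
  ((z - (1 - (p j : ℂ))) / (p j : ℂ)) ^ d j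

/-- `ftil j = f j ∘ ... ∘ f 1`, with `ftil 0 = id`. -/
def ftil (d : ℕ → ℕ) (p : ℕ → ℝ) : ℕ → ℂ → ℂ
  | 0 => id
  | j + 1 => f d p (j + 1) ∘ ftil d p j

/-- The fibered filled Julia set `E = {z : limsup_j |ftil j z| < ∞}`. -/
def E (d : ℕ → ℕ) (p : ℕ → ℝ) : Set ℂ :=
  {z | Filter.limsup (fun j => (‖ftil d p j z‖₊ : ℝ≥0∞)) Filter.atTop < ⊤}

/-- `ι_λ(r) = (ftil (r-1) λ - (1 - p r)) / p r` for `r ≥ 1`. -/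
def iota (d : ℕ → ℕ) (p : ℕ → ℝ) (lam : ℂ) (r : ℕ) : ℂ :=
  (ftil d p (r - 1) lam - (1 - (p r : ℂ))) / (p r : ℂ)

/-- `v_λ(n) = ∏_{r ≥ 1} ι_λ(r) ^ a_r(n)`, a finite product. -/
def vlam (d : ℕ → ℕ) (p : ℕ → ℝ) (lam : ℂ) (n : ℕ) : ℂ :=
  ∏ᶠ r : ℕ, iota d p lam (r + 1) ^ digit d n (r + 1)

/-- The point spectrum of a continuous linear operator. -/
def pointSpectrum {M : Type*} [NormedAddCommGroup M] [NormedSpace ℂ M]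
    (T : M →L[ℂ] M) : Set ℂ :=
  {lam | ∃ v, v ≠ 0 ∧ T v = lam • v}

/-- The residual spectrum: `T - λI` is injective but its range is not dense. -/
def residualSpectrum {M : Type*} [NormedAddCommGroup M] [NormedSpace ℂ M]
    (T : M →L[ℂ] M) : Set ℂ :=
  {lam | Function.Injective ⇑(T - lam • (1 : M →L[ℂ] M)) ∧
    ¬ DenseRange ⇑(T - lam • (1 : M →L[ℂ] M))}

/-- The continuous spectrum: `T - λI` is injective with dense range, but not surjective. -/
def continuousSpectrum {M : Type*} [NormedAddCommGroup M] [NormedSpace ℂ M]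
    (T : M →L[ℂ] M) : Set ℂ :=
  {lam | Function.Injective ⇑(T - lam • (1 : M →L[ℂ] M)) ∧
    DenseRange ⇑(T - lam • (1 : M →L[ℂ] M)) ∧
    Set.range ⇑(T - lam • (1 : M →L[ℂ] M)) ≠ Set.univ}

/-- `PP p k = p 1 * ... * p k`. -/
def PP (p : ℕ → ℝ) (k : ℕ) : ℝ := ∏ j ∈ Finset.Icc 1 k, p j

lemma PP_zero (p : ℕ → ℝ) : PP p 0 = 1 := by simp [PP]

lemma PP_succ (p : ℕ → ℝ) (k : ℕ) : PP p (k + 1) = PP p k * p (k + 1) := by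
  unfold PP
  rw [Finset.prod_Icc_succ_top (by omega)]

lemma PP_pos (p : ℕ → ℝ) (hp : ∀ j, 1 ≤ j → p j ∈ Set.Ioc (0 : ℝ) 1) (k : ℕ) : 0 < PP p k :=
  Finset.prod_pos fun j hj => (hp j (Finset.mem_Icc.1 hj).1).1

lemma q_zero (d : ℕ → ℕ) (hd0 : d 0 = 1) : q d 0 = 1 := by simp [q, hd0]

lemma q_succ (d : ℕ → ℕ) (k : ℕ) : q d (k + 1) = q d k * d (k + 1) := by
  unfold q
  rw [Finset.prod_range_succ]

lemma q_pos (d : ℕ → ℕ) (hd0 : d 0 = 1) (hd : ∀ j, 1 ≤ j → 2 ≤ d j) (k : ℕ) : 0 < q d k := by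
  induction k with
  | zero => rw [q_zero d hd0]; omega
  | succ k ih =>
    rw [q_succ]
    exact Nat.mul_pos ih (by have := hd (k + 1) (by omega); omega)

lemma q_strictMono (d : ℕ → ℕ) (hd0 : d 0 = 1) (hd : ∀ j, 1 ≤ j → 2 ≤ d j) :
    StrictMono (q d) := by
  refine strictMono_nat_of_lt_succ fun k => ?_
  rw [q_succ]
  have := hd (k + 1) (by omega)
  have := q_pos d hd0 hd k
  nlinarith

lemma q_dvd (d : ℕ → ℕ) {i j : ℕ} (h : i ≤ j) : q d i ∣ q d j := by
  induction j, h using Nat.le_induction with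
  | base => exact dvd_rfl
  | succ j _ ih => rw [q_succ]; exact ih.mul_right _

lemma sum_q (d : ℕ → ℕ) (hd0 : d 0 = 1) (hd : ∀ j, 1 ≤ j → 2 ≤ d j) (r : ℕ) :
    ∑ j ∈ Finset.Icc 1 r, (d j - 1) * q d (j - 1) + 1 = q d r := by
  induction r with
  | zero => simp [q_zero d hd0]
  | succ r ih =>
    rw [Finset.sum_Icc_succ_top (by omega), q_succ, ← ih]
    have := hd (r + 1) (by omega)
    obtain ⟨e, he⟩ : ∃ e, d (r + 1) = e + 1 := ⟨d (r + 1) - 1, by omega⟩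
    simp only [he, Nat.add_sub_cancel, ← ih]
    ring

/-- The first level of non divisibility, over the integers. -/
lemma exists_level (d : ℕ → ℕ) (hd0 : d 0 = 1) (hd : ∀ j, 1 ≤ j → 2 ≤ d j) (M : ℤ) (hM : M ≠ 0) :
    ∃ k, (q d k : ℤ) ∣ M ∧ ¬ (q d (k + 1) : ℤ) ∣ M := by
  by_contra! h
  have hall : ∀ k, (q d k : ℤ) ∣ M := by
    intro k
    induction k with
    | zero => simp [q_zero d hd0]
    | succ k ih => exact h k ih
  have h1 := Int.natAbs_dvd_natAbs.2 (hall (M.natAbs + 1))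
  have h2 := Nat.le_of_dvd (by omega) h1
  have h3 := (q_strictMono d hd0 hd).le_apply (x := M.natAbs + 1)
  simp only [Int.natAbs_natCast] at h2
  omega

lemma q_dvd_succ_iff (d : ℕ → ℕ) (hd0 : d 0 = 1) (hd : ∀ j, 1 ≤ j → 2 ≤ d j) (n k : ℕ)
    (h : q d k ∣ n + 1) :
    q d (k + 1) ∣ n + 1 ↔ digit d n (k + 1) = d (k + 1) - 1 := by
  obtain ⟨u, hu⟩ := h
  have hq := q_pos d hd0 hd k
  have hd' := hd (k + 1) (by omega)
  have hu0 : 0 < u := by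
    rcases Nat.eq_zero_or_pos u with h | h
    · subst h; simp at hu
    · exact h
  obtain ⟨v, rfl⟩ : ∃ v, u = v + 1 := ⟨u - 1, by omega⟩
  have hdiv : n / q d k = v := by
    have : n = q d k * v + (q d k - 1) := by
      have : n + 1 = q d k * v + q d k := by rw [hu]; ring
      omega
    rw [this, Nat.mul_add_div hq, Nat.div_eq_of_lt (by omega)]
    simp
  unfold digit
  rw [Nat.add_sub_cancel, hdiv, hu, q_succ, Nat.mul_dvd_mul_iff_left hq]
  constructor
  · intro h
    obtain ⟨c, hc⟩ := h
    obtain ⟨c', rfl⟩ : ∃ c', c = c' + 1 := ⟨c - 1, by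
      rcases Nat.eq_zero_or_pos c with h | h
      · subst h; simp at hc
      · omega⟩
    have : v = d (k + 1) * c' + (d (k + 1) - 1) := by
      have : v + 1 = d (k + 1) * c' + d (k + 1) := by rw [hc]; ring
      omega
    rw [this, Nat.mul_add_mod, Nat.mod_eq_of_lt (by omega)]
  · intro h
    have := Nat.div_add_mod v (d (k + 1))
    rw [h] at this
    refine ⟨v / d (k + 1) + 1, ?_⟩
    rw [Nat.mul_add]
    omega

lemma zeta_set_nonempty (d : ℕ → ℕ) (hd0 : d 0 = 1) (hd : ∀ j, 1 ≤ j → 2 ≤ d j) (n : ℕ) :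
    {j | 1 ≤ j ∧ digit d n j ≠ d j - 1}.Nonempty := by
  refine ⟨n + 1, by omega, ?_⟩
  have h3 := (q_strictMono d hd0 hd).le_apply (x := n + 1)
  have h4 := (q_strictMono d hd0 hd).le_apply (x := n)
  have hd' := hd (n + 1) (by omega)
  unfold digit
  rw [Nat.add_sub_cancel]
  by_contra h
  rcases Nat.lt_or_ge n (q d n) with h' | h'
  · rw [Nat.div_eq_of_lt h'] at h; simp at h; omega
  · have e : q d n = n := by omega
    have := (q_strictMono d hd0 hd)
    rcases Nat.eq_zero_or_pos n with h0 | h0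
    · subst h0; rw [q_zero d hd0] at e; omega
    · obtain ⟨k, rfl⟩ : ∃ k, n = k + 1 := ⟨n - 1, by omega⟩
      have h5 : ∀ k, k + 1 ≤ q d k := by
        intro k
        induction k with
        | zero => rw [q_zero d hd0]
        | succ k ih => have := this (Nat.lt_succ_self k); simp only [Nat.succ_eq_add_one] at this; omega
      have := h5 (k + 1)
      omega

lemma zeta_eq (d : ℕ → ℕ) (hd0 : d 0 = 1) (hd : ∀ j, 1 ≤ j → 2 ≤ d j) (n k : ℕ)
    (h1 : q d k ∣ n + 1) (h2 : ¬ q d (k + 1) ∣ n + 1) : zeta d n = k + 1 := by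
  unfold zeta
  apply le_antisymm
  · apply Nat.sInf_le
    refine ⟨by omega, ?_⟩
    rwa [Ne, ← q_dvd_succ_iff d hd0 hd n k h1]
  · apply le_csInf (zeta_set_nonempty d hd0 hd n)
    rintro j ⟨hj1, hj⟩
    by_contra hlt
    obtain ⟨i, rfl⟩ : ∃ i, j = i + 1 := ⟨j - 1, by omega⟩
    apply hj
    rw [← q_dvd_succ_iff d hd0 hd n i ((q_dvd d (by omega)).trans h1)]
    exact (q_dvd d (by omega)).trans h1

lemma exists_level_nat (d : ℕ → ℕ) (hd0 : d 0 = 1) (hd : ∀ j, 1 ≤ j → 2 ≤ d j) (n : ℕ) :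
    ∃ k, q d k ∣ n + 1 ∧ ¬ q d (k + 1) ∣ n + 1 := by
  obtain ⟨k, h1, h2⟩ := exists_level d hd0 hd ((n + 1 : ℕ) : ℤ) (by omega)
  exact ⟨k, Int.natCast_dvd_natCast.1 h1, fun h => h2 (Int.natCast_dvd_natCast.2 h)⟩

lemma le_zeta_iff (d : ℕ → ℕ) (hd0 : d 0 = 1) (hd : ∀ j, 1 ≤ j → 2 ≤ d j) (n r : ℕ) :
    r + 1 ≤ zeta d n ↔ q d r ∣ n + 1 := by
  obtain ⟨k, h1, h2⟩ := exists_level_nat d hd0 hd n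
  rw [zeta_eq d hd0 hd n k h1 h2]
  constructor
  · intro h; exact (q_dvd d (by omega)).trans h1
  · intro h
    by_contra hlt
    exact h2 ((q_dvd d (by omega)).trans h)

lemma s_succ (d : ℕ → ℕ) (p : ℕ → ℝ) (hd0 : d 0 = 1) (hd : ∀ j, 1 ≤ j → 2 ≤ d j) (n k : ℕ)
    (h1 : q d k ∣ n + 1) (h2 : ¬ q d (k + 1) ∣ n + 1) : s d p n (n + 1) = PP p (k + 1) := by
  simp [s, PP, zeta_eq d hd0 hd n k h1 h2]

lemma s_back (d : ℕ → ℕ) (p : ℕ → ℝ) (hd0 : d 0 = 1) (hd : ∀ j, 1 ≤ j → 2 ≤ d j) (n m r : ℕ)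
    (h1 : q d r ∣ n + 1) (h2 : n + 1 = m + q d r) :
    s d p n m = (1 - p (r + 1)) * PP p r := by
  have hq := q_pos d hd0 hd r
  unfold s
  rw [if_neg (by omega)]
  rcases Nat.eq_zero_or_pos r with h0 | h0
  · subst h0
    rw [q_zero d hd0] at h2
    rw [if_pos (by omega), PP_zero]
    simp
  · have hqr := q_strictMono d hd0 hd h0
    rw [q_zero d hd0] at hqr
    rw [if_neg (by omega)]
    have hex : ∃ r, 1 ≤ r ∧ r + 1 ≤ zeta d n ∧
      n = m + ∑ j ∈ Finset.Icc 1 r, (d j - 1) * q d (j - 1) := by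
      refine ⟨r, h0, (le_zeta_iff d hd0 hd n r).2 h1, ?_⟩
      have := sum_q d hd0 hd r
      omega
    rw [dif_pos hex]
    have hc : hex.choose = r := by
      have h3 := hex.choose_spec.2.2
      have := sum_q d hd0 hd hex.choose
      apply (q_strictMono d hd0 hd).injective
      omega
    rw [hc, PP]

lemma s_eq_zero (d : ℕ → ℕ) (p : ℕ → ℝ) (hd0 : d 0 = 1) (hd : ∀ j, 1 ≤ j → 2 ≤ d j) (n m : ℕ)
    (h1 : m ≠ n + 1) (h2 : ∀ r, q d r ∣ n + 1 → n + 1 ≠ m + q d r) :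
    s d p n m = 0 := by
  unfold s
  rw [if_neg h1, if_neg, dif_neg]
  · rintro ⟨r, _, hr2, hr3⟩
    refine h2 r ((le_zeta_iff d hd0 hd n r).1 hr2) ?_
    have := sum_q d hd0 hd r
    omega
  · rintro rfl
    exact h2 0 (by simp [q_zero d hd0]) (by simp [q_zero d hd0])

/-! ### The abstract telescoping argument on the integers -/

lemma ftil_succ_iota (d : ℕ → ℕ) (p : ℕ → ℝ) (lam : ℂ) (k : ℕ) :
    ftil d p (k + 1) lam = iota d p lam (k + 1) ^ d (k + 1) := rfl

lemma iota_mul (d : ℕ → ℕ) (p : ℕ → ℝ) (hp : ∀ j, 1 ≤ j → p j ∈ Set.Ioc (0 : ℝ) 1)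
    (lam : ℂ) (k : ℕ) :
    (p (k + 1) : ℂ) * iota d p lam (k + 1) = ftil d p k lam - (1 - (p (k + 1) : ℂ)) := by
  have : (p (k + 1) : ℂ) ≠ 0 := by exact_mod_cast (hp (k + 1) (by omega)).1.ne'
  unfold iota
  rw [Nat.add_sub_cancel]
  field_simp

/-- The relation at level `j`. -/
def Rel (d : ℕ → ℕ) (p : ℕ → ℝ) (lam : ℂ) (H : ℤ → ℂ) (D : ℤ → Prop) (j : ℕ) : Prop :=
  ∀ x : ℤ, D x → (q d j : ℤ) ∣ x → ¬ (q d (j + 1) : ℤ) ∣ x →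
    H x = iota d p lam (j + 1) * H (x - q d j)

lemma rel_iterate (d : ℕ → ℕ) (p : ℕ → ℝ) (hd0 : d 0 = 1) (hd : ∀ j, 1 ≤ j → 2 ≤ d j)
    (lam : ℂ) (H : ℤ → ℂ) (D : ℤ → Prop) (j : ℕ) (hF : Rel d p lam H D j) (M : ℤ)
    (hM : (q d (j + 1) : ℤ) ∣ M) (hD : ∀ x, M - q d (j + 1) < x → x < M → D x) :
    H (M - q d j) = iota d p lam (j + 1) ^ (d (j + 1) - 1) * H (M - q d (j + 1)) := by
  have hd' := hd (j + 1) (by omega)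
  have hq := q_pos d hd0 hd j
  have key : ∀ t : ℕ, t + 1 ≤ d (j + 1) →
      H (M - q d j) = iota d p lam (j + 1) ^ t * H (M - (q d j : ℤ) * (t + 1 : ℕ)) := by
    intro t
    induction t with
    | zero => intro _; simp
    | succ t ih =>
      intro ht
      rw [ih (by omega)]
      have hlt : (q d j : ℤ) * (t + 1 : ℕ) < q d (j + 1) := by
        rw [q_succ]; push_cast
        have : (0:ℤ) < q d j := by exact_mod_cast hq
        have : ((t + 1 : ℕ) : ℤ) < d (j + 1) := by exact_mod_cast (by omega : t + 1 < d (j + 1))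
        push_cast at this
        nlinarith
      have hpos : 0 < (q d j : ℤ) * (t + 1 : ℕ) := by positivity
      rw [hF (M - (q d j : ℤ) * (t + 1 : ℕ)) (hD _ (by omega) (by omega))]
      · rw [pow_succ, mul_assoc]
        congr 3
        push_cast
        ring
      · refine dvd_sub (dvd_trans ?_ hM) (dvd_mul_right _ _)
        exact_mod_cast q_dvd d (Nat.le_succ j)
      · intro h
        have h' := (dvd_sub_right hM).1 h
        exact absurd (Int.le_of_dvd hpos h') (by omega)
  have := key (d (j + 1) - 1) (by omega)
  rw [this, q_succ]
  congr 3
  rw [Nat.sub_add_cancel (by omega)]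
  push_cast
  ring

lemma telescope (d : ℕ → ℕ) (p : ℕ → ℝ) (hd0 : d 0 = 1) (hd : ∀ j, 1 ≤ j → 2 ≤ d j)
    (hp : ∀ j, 1 ≤ j → p j ∈ Set.Ioc (0 : ℝ) 1)
    (lam : ℂ) (H : ℤ → ℂ) (D : ℤ → Prop) (k : ℕ) (hF : ∀ j < k, Rel d p lam H D j) (M : ℤ)
    (hM : (q d k : ℤ) ∣ M) (hD : ∀ x, M - q d k < x → x < M → D x) :
    lam * H (M - 1) - ∑ r ∈ Finset.range k, (1 - (p (r + 1) : ℂ)) * PP p r * H (M - q d r)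
      = PP p k * ftil d p k lam * H (M - q d k) := by
  induction k with
  | zero => simp [PP_zero, ftil, q_zero d hd0]
  | succ k ih =>
    have hlt : (q d k : ℤ) < q d (k + 1) := by
      exact_mod_cast q_strictMono d hd0 hd (Nat.lt_succ_self k)
    have ih' := ih (fun j hj => hF j (by omega))
      (dvd_trans (by exact_mod_cast q_dvd d (Nat.le_succ k)) hM)
      (fun x hx hx' => hD x (by omega) hx')
    rw [Finset.sum_range_succ, ← sub_sub, ih',
      rel_iterate d p hd0 hd lam H D k (hF k (by omega)) M hM hD, PP_succ, ftil_succ_iota]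
    have h := iota_mul d p hp lam k
    have hd' := hd (k + 1) (by omega)
    have e : iota d p lam (k + 1) ^ d (k + 1)
        = iota d p lam (k + 1) * iota d p lam (k + 1) ^ (d (k + 1) - 1) := by
      rw [← pow_succ', Nat.sub_add_cancel (by omega)]
    rw [e]
    push_cast
    linear_combination (- (PP p k : ℂ) * iota d p lam (k + 1) ^ (d (k + 1) - 1)
      * H (M - q d (k + 1))) * h

/-- The local equation at `M` of level `k`. -/
def LocalEq (d : ℕ → ℕ) (p : ℕ → ℝ) (lam : ℂ) (H : ℤ → ℂ) (k : ℕ) (M : ℤ) : Prop :=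
  PP p (k + 1) * H M + ∑ r ∈ Finset.range (k + 1), (1 - (p (r + 1) : ℂ)) * PP p r * H (M - q d r)
    = lam * H (M - 1)

lemma localEq_iff (d : ℕ → ℕ) (p : ℕ → ℝ) (hd0 : d 0 = 1) (hd : ∀ j, 1 ≤ j → 2 ≤ d j)
    (hp : ∀ j, 1 ≤ j → p j ∈ Set.Ioc (0 : ℝ) 1)
    (lam : ℂ) (H : ℤ → ℂ) (D : ℤ → Prop) (k : ℕ) (hF : ∀ j < k, Rel d p lam H D j) (M : ℤ)
    (hM : (q d k : ℤ) ∣ M) (hD : ∀ x, M - q d k < x → x < M → D x) :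
    LocalEq d p lam H k M ↔ H M = iota d p lam (k + 1) * H (M - q d k) := by
  have ht := telescope d p hd0 hd hp lam H D k hF M hM hD
  have hpos : (PP p (k + 1) : ℂ) ≠ 0 := by exact_mod_cast (PP_pos p hp (k + 1)).ne'
  have h := iota_mul d p hp lam k
  have key : PP p (k + 1) * H M +
      ∑ r ∈ Finset.range (k + 1), (1 - (p (r + 1) : ℂ)) * PP p r * H (M - q d r)
      - lam * H (M - 1) = PP p (k + 1) * (H M - iota d p lam (k + 1) * H (M - q d k)) := by
    rw [Finset.sum_range_succ]
    have e : (PP p (k + 1) : ℂ) = PP p k * p (k + 1) := by exact_mod_cast PP_succ p k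
    rw [e]
    linear_combination (-1 : ℂ) * ht + (PP p k : ℂ) * H (M - q d k) * h
  unfold LocalEq
  rw [← sub_eq_zero, key, mul_eq_zero, or_iff_right hpos, sub_eq_zero]

lemma rel_of_localEq (d : ℕ → ℕ) (p : ℕ → ℝ) (hd0 : d 0 = 1) (hd : ∀ j, 1 ≤ j → 2 ≤ d j)
    (hp : ∀ j, 1 ≤ j → p j ∈ Set.Ioc (0 : ℝ) 1)
    (lam : ℂ) (H : ℤ → ℂ) (D : ℤ → Prop)
    (hD : ∀ k M, D M → (q d k : ℤ) ∣ M → ∀ x, M - q d k < x → x < M → D x)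
    (hE : ∀ k M, D M → (q d k : ℤ) ∣ M → ¬ (q d (k + 1) : ℤ) ∣ M → LocalEq d p lam H k M)
    (k : ℕ) : Rel d p lam H D k := by
  induction k using Nat.strong_induction_on with
  | _ k ih =>
    intro x hx h1 h2
    exact (localEq_iff d p hd0 hd hp lam H D k ih x h1 (hD k x hx h1)).1 (hE k x hx h1 h2)

lemma ftil_one (d : ℕ → ℕ) (p : ℕ → ℝ) (hp : ∀ j, 1 ≤ j → p j ∈ Set.Ioc (0 : ℝ) 1)
    (lam : ℂ) (N : ℕ) (hN : ftil d p N lam = 1) (k : ℕ) (hk : N ≤ k) :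
    ftil d p k lam = 1 ∧ iota d p lam (k + 1) = 1 := by
  have aux : ∀ k, ftil d p k lam = 1 → iota d p lam (k + 1) = 1 := by
    intro k h
    have : (p (k + 1) : ℂ) ≠ 0 := by exact_mod_cast (hp (k + 1) (by omega)).1.ne'
    simp [iota, h, this]
  induction k, hk using Nat.le_induction with
  | base => exact ⟨hN, aux _ hN⟩
  | succ k _ ih =>
    have : ftil d p (k + 1) lam = 1 := by rw [ftil_succ_iota, ih.2, one_pow]
    exact ⟨this, aux _ this⟩

/-! ### Rows and columns of the transition matrix -/

lemma row_sum (d : ℕ → ℕ) (p : ℕ → ℝ) (hd0 : d 0 = 1) (hd : ∀ j, 1 ≤ j → 2 ≤ d j) (n k : ℕ)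
    (h1 : q d k ∣ n + 1) (h2 : ¬ q d (k + 1) ∣ n + 1) (g : ℕ → ℂ) :
    ∑' m, (s d p n m : ℂ) * g m = PP p (k + 1) * g (n + 1) +
      ∑ r ∈ Finset.range (k + 1), (1 - (p (r + 1) : ℂ)) * PP p r * g (n + 1 - q d r) := by
  have hle : ∀ r, q d r ∣ n + 1 → q d r ≤ n + 1 := fun r h => Nat.le_of_dvd (by omega) h
  have hdv : ∀ r ∈ Finset.range (k + 1), q d r ∣ n + 1 := fun r hr =>
    (q_dvd d (by rw [Finset.mem_range] at hr; omega)).trans h1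
  rw [tsum_eq_sum (s := insert (n + 1) ((Finset.range (k + 1)).image fun r => n + 1 - q d r))]
  · rw [Finset.sum_insert, Finset.sum_image, s_succ d p hd0 hd n k h1 h2]
    · congr 1
      refine Finset.sum_congr rfl fun r hr => ?_
      have := hle r (hdv r hr)
      rw [s_back d p hd0 hd n (n + 1 - q d r) r (hdv r hr) (by omega)]
      push_cast
      ring
    · intro a ha b hb hab
      have h3 := hle a (hdv a ha)
      have h4 := hle b (hdv b hb)
      simp only at hab
      exact (q_strictMono d hd0 hd).injective (by omega)
    · simp only [Finset.mem_image, not_exists, not_and]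
      intro r hr
      have := q_pos d hd0 hd r
      omega
  · intro m hm
    simp only [Finset.mem_insert, Finset.mem_image, not_or, not_exists, not_and] at hm
    rw [s_eq_zero d p hd0 hd n m hm.1]
    · simp
    · intro r hr he
      refine hm.2 r ?_ (by omega)
      rw [Finset.mem_range]
      by_contra hlt
      exact h2 ((q_dvd d (by omega)).trans hr)

lemma col_sum (d : ℕ → ℕ) (p : ℕ → ℝ) (hd0 : d 0 = 1) (hd : ∀ j, 1 ≤ j → 2 ≤ d j) (n k : ℕ)
    (h1 : q d k ∣ n + 1) (h2 : ¬ q d (k + 1) ∣ n + 1) (g : ℕ → ℂ) :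
    HasSum (fun m => (s d p m (n + 1) : ℂ) * g m) (PP p (k + 1) * g n +
      ∑ r ∈ Finset.range (k + 1), (1 - (p (r + 1) : ℂ)) * PP p r * g (n + q d r)) := by
  have hdv : ∀ r ∈ Finset.range (k + 1), q d r ∣ n + 1 := fun r hr =>
    (q_dvd d (by rw [Finset.mem_range] at hr; omega)).trans h1
  have hval : ∑ m ∈ insert n ((Finset.range (k + 1)).image fun r => n + q d r),
      (s d p m (n + 1) : ℂ) * g m = PP p (k + 1) * g n +
      ∑ r ∈ Finset.range (k + 1), (1 - (p (r + 1) : ℂ)) * PP p r * g (n + q d r) := by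
    rw [Finset.sum_insert, Finset.sum_image, s_succ d p hd0 hd n k h1 h2]
    · congr 1
      refine Finset.sum_congr rfl fun r hr => ?_
      rw [s_back d p hd0 hd (n + q d r) (n + 1) r _ (by omega)]
      · push_cast
        ring
      · rw [show n + q d r + 1 = n + 1 + q d r by omega]
        exact (hdv r hr).add dvd_rfl
    · intro a ha b hb hab
      simp only at hab
      exact (q_strictMono d hd0 hd).injective (by omega)
    · simp only [Finset.mem_image, not_exists, not_and]
      intro r hr
      have := q_pos d hd0 hd r
      omega
  rw [← hval]
  apply hasSum_sum_of_ne_finset_zero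
  intro m hm
  simp only [Finset.mem_insert, Finset.mem_image, not_or, not_exists, not_and] at hm
  rw [s_eq_zero d p hd0 hd m (n + 1) (by omega)]
  · simp
  · intro r hr he
    refine hm.2 r ?_ (by omega)
    rw [Finset.mem_range]
    by_contra hlt
    have h3 : q d r ∣ n + 1 := by
      rw [he] at hr
      exact (Nat.dvd_add_left dvd_rfl).1 hr
    exact h2 ((q_dvd d (by omega)).trans h3)

lemma col_zero (d : ℕ → ℕ) (p : ℕ → ℝ) (hd0 : d 0 = 1) (hd : ∀ j, 1 ≤ j → 2 ≤ d j) (g : ℕ → ℂ)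
    (a : ℂ) (h : HasSum (fun m => (s d p m 0 : ℂ) * g m) a) :
    Tendsto (fun k => ∑ r ∈ Finset.range k, (1 - (p (r + 1) : ℂ)) * PP p r * g (q d r - 1))
      atTop (𝓝 a) := by
  have hinj : Function.Injective fun r => q d r - 1 := by
    intro a b hab
    have := q_pos d hd0 hd a
    have := q_pos d hd0 hd b
    simp only at hab
    exact (q_strictMono d hd0 hd).injective (by omega)
  rw [← hinj.hasSum_iff] at h
  · have h' := h.tendsto_sum_nat
    refine h'.congr fun k => Finset.sum_congr rfl fun r _ => ?_
    have := q_pos d hd0 hd r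
    simp only [Function.comp]
    have e : q d r - 1 + 1 = q d r := by omega
    rw [s_back d p hd0 hd (q d r - 1) 0 r (by rw [e]) (by omega)]
    push_cast
    ring
  · intro m hm
    rw [s_eq_zero d p hd0 hd m 0 (by omega)]
    · simp
    · intro r _ he
      exact hm ⟨r, by simp only; omega⟩

/-! ### Injectivity -/

lemma eigen_zero (d : ℕ → ℕ) (p : ℕ → ℝ)
    (hd0 : d 0 = 1) (hd : ∀ j, 1 ≤ j → 2 ≤ d j)
    (hp : ∀ j, 1 ≤ j → p j ∈ Set.Ioc (0 : ℝ) 1) (lam : ℂ) (N : ℕ) (hN : ftil d p N lam = 1)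
    (w : ℕ → ℂ) (hw : Tendsto w atTop (𝓝 0))
    (hE : ∀ n, ∑' m, (s d p n m : ℂ) * w m = lam * w n) : w = 0 := by
  have hR := rel_of_localEq d p hd0 hd hp lam (fun x => w x.toNat) (fun x => 0 < x)
    (by
      intro k M hM hk x hx _
      have := Int.le_of_dvd hM hk
      omega)
    (by
      intro k M hM hk hk'
      obtain ⟨n, rfl⟩ : ∃ n : ℕ, M = ((n + 1 : ℕ) : ℤ) := ⟨(M - 1).toNat, by omega⟩
      have h1 := Int.natCast_dvd_natCast.1 hk
      have h2 : ¬ q d (k + 1) ∣ n + 1 := fun h => hk' (Int.natCast_dvd_natCast.2 h)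
      have h3 := hE n
      rw [row_sum d p hd0 hd n k h1 h2] at h3
      unfold LocalEq
      have e : (((n + 1 : ℕ) : ℤ) - 1).toNat = n := by omega
      simp only [e, Int.toNat_natCast]
      rw [← h3]
      congr 1
      refine Finset.sum_congr rfl fun r _ => ?_
      congr 2
      omega)
  have h0 : w 0 = 0 := by
    have hc : ∀ k, N ≤ k → w (q d k) = w 0 := by
      intro k hk
      have hpos := q_pos d hd0 hd k
      have h := hR k (q d k) (by omega) dvd_rfl (by
        intro h
        have h1 := Int.natCast_dvd_natCast.1 h
        have h2 := Nat.le_of_dvd hpos h1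
        have h3 := q_strictMono d hd0 hd (Nat.lt_succ_self k)
        simp only [Nat.succ_eq_add_one] at h3
        omega)
      rw [(ftil_one d p hp lam N hN k hk).2] at h
      simpa using h
    have h1 : Tendsto (fun k => w (q d k)) atTop (𝓝 0) :=
      hw.comp (q_strictMono d hd0 hd).tendsto_atTop
    have h2 : Tendsto (fun k => w (q d k)) atTop (𝓝 (w 0)) := by
      refine tendsto_const_nhds.congr' ?_
      filter_upwards [eventually_ge_atTop N] with k hk
      exact (hc k hk).symm
    exact tendsto_nhds_unique h2 h1
  funext n
  induction n using Nat.strong_induction_on with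
  | _ n ih =>
    rcases Nat.eq_zero_or_pos n with h | h
    · subst h; exact h0
    · obtain ⟨k, h1, h2⟩ := exists_level d hd0 hd (n : ℤ) (by omega)
      have h3 := hR k n (by omega) h1 h2
      have hpos := q_pos d hd0 hd k
      have h4 := ih (((n : ℤ) - q d k).toNat) (by omega)
      simp only [h4, Int.toNat_natCast, Pi.zero_apply, mul_zero] at h3
      simpa using h3

/-! ### Left eigenvectors -/

lemma left_rel (d : ℕ → ℕ) (p : ℕ → ℝ)
    (hd0 : d 0 = 1) (hd : ∀ j, 1 ≤ j → 2 ≤ d j)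
    (hp : ∀ j, 1 ≤ j → p j ∈ Set.Ioc (0 : ℝ) 1) (lam : ℂ)
    (φ : ℕ → ℂ) (hE : ∀ m, HasSum (fun n => (s d p n m : ℂ) * φ n) (lam * φ m)) (k : ℕ) :
    Rel d p lam (fun x => φ (-x - 1).toNat) (fun x => x < 0) k := by
  refine rel_of_localEq d p hd0 hd hp lam _ _ (fun k M hM _ x _ hx => lt_trans hx hM) ?_ k
  intro k M hM hk hk'
  obtain ⟨n, rfl⟩ : ∃ n : ℕ, M = -((n + 1 : ℕ) : ℤ) := ⟨(-M - 1).toNat, by omega⟩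
  rw [dvd_neg] at hk hk'
  have h1 := Int.natCast_dvd_natCast.1 hk
  have h2 : ¬ q d (k + 1) ∣ n + 1 := fun h => hk' (Int.natCast_dvd_natCast.2 h)
  have h3 := (col_sum d p hd0 hd n k h1 h2 φ).unique (hE (n + 1))
  unfold LocalEq
  have e1 : (- (-((n + 1 : ℕ) : ℤ)) - 1).toNat = n := by omega
  have e2 : (- (-((n + 1 : ℕ) : ℤ) - 1) - 1).toNat = n + 1 := by omega
  simp only [e1, e2]
  rw [← h3]
  congr 1
  refine Finset.sum_congr rfl fun r _ => ?_
  congr 2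
  omega

lemma left_tele (d : ℕ → ℕ) (p : ℕ → ℝ)
    (hd0 : d 0 = 1) (hd : ∀ j, 1 ≤ j → 2 ≤ d j)
    (hp : ∀ j, 1 ≤ j → p j ∈ Set.Ioc (0 : ℝ) 1) (lam : ℂ) (φ : ℕ → ℂ)
    (hR : ∀ k, Rel d p lam (fun x => φ (-x - 1).toNat) (fun x => x < 0) k) (k : ℕ) :
    lam * φ 0 - ∑ r ∈ Finset.range k, (1 - (p (r + 1) : ℂ)) * PP p r * φ (q d r - 1)
      = PP p k * ftil d p k lam * φ (q d k - 1) := by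
  have h := telescope d p hd0 hd hp lam _ _ k (fun j _ => hR j) 0 (dvd_zero _)
    (fun x _ hx => hx)
  have e : ∀ r, (-((0 : ℤ) - q d r) - 1).toNat = q d r - 1 := by intro r; omega
  simp only [e] at h
  simpa using h

lemma left_zero (d : ℕ → ℕ) (p : ℕ → ℝ)
    (hd0 : d 0 = 1) (hd : ∀ j, 1 ≤ j → 2 ≤ d j)
    (hp : ∀ j, 1 ≤ j → p j ∈ Set.Ioc (0 : ℝ) 1) (lam : ℂ) (N : ℕ) (hN : ftil d p N lam = 1)
    (L : ℝ) (hL : 0 < L) (hPL : Tendsto (fun n => PP p n) atTop (𝓝 L))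
    (φ : ℕ → ℂ) (hE : ∀ m, HasSum (fun n => (s d p n m : ℂ) * φ n) (lam * φ m)) : φ = 0 := by
  have hR := left_rel d p hd0 hd hp lam φ hE
  have ht := left_tele d p hd0 hd hp lam φ hR
  have hc := col_zero d p hd0 hd φ _ (hE 0)
  have hcst : ∀ k, N ≤ k → φ (q d k - 1) = φ (q d N - 1) := by
    intro k hk
    induction k, hk using Nat.le_induction with
    | base => rfl
    | succ k hk ih =>
      have h := rel_iterate d p hd0 hd lam _ _ k (hR k) 0 (dvd_zero _) (fun x _ hx => hx)
      rw [(ftil_one d p hp lam N hN k hk).2, one_pow, one_mul] at h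
      have e : ∀ r, (-((0 : ℤ) - q d r) - 1).toNat = q d r - 1 := by intro r; omega
      simp only [e] at h
      rw [← h, ih]
  have h0 : φ (q d N - 1) = 0 := by
    have h1 : Tendsto (fun k => (PP p k : ℂ) * φ (q d N - 1)) atTop (𝓝 0) := by
      have h2 := (tendsto_const_nhds (x := lam * φ 0)).sub hc
      rw [sub_self] at h2
      refine h2.congr' ?_
      filter_upwards [eventually_ge_atTop N] with k hk
      rw [ht, (ftil_one d p hp lam N hN k hk).1, hcst k hk, mul_one]
    have h3 : Tendsto (fun k => (PP p k : ℂ) * φ (q d N - 1)) atTop (𝓝 (L * φ (q d N - 1))) :=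
      ((Complex.continuous_ofReal.tendsto L).comp hPL).mul_const _
    have h4 := tendsto_nhds_unique h3 h1
    have : (L : ℂ) ≠ 0 := by exact_mod_cast hL.ne'
    simpa [this] using h4
  have key : ∀ K, N ≤ K → ∀ t n, n + 1 + t = q d K → φ n = 0 := by
    intro K hK t
    induction t using Nat.strong_induction_on with
    | _ t ih =>
      intro n hn
      rcases Nat.eq_zero_or_pos t with h | h
      · have : n = q d K - 1 := by omega
        rw [this, hcst K hK, h0]
      · obtain ⟨k, h1, h2⟩ := exists_level_nat d hd0 hd n
        have h3 := hR k (-((n + 1 : ℕ) : ℤ)) (by omega)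
          (by rw [dvd_neg]; exact Int.natCast_dvd_natCast.2 h1)
          (by rw [dvd_neg]; exact fun h => h2 (Int.natCast_dvd_natCast.1 h))
        have e1 : (- (-((n + 1 : ℕ) : ℤ)) - 1).toNat = n := by omega
        have e2 : (- (-((n + 1 : ℕ) : ℤ) - q d k) - 1).toNat = n + q d k := by omega
        simp only [e1, e2] at h3
        have hpos := q_pos d hd0 hd k
        have hkK : k < K := by
          by_contra hlt
          have := Nat.le_of_dvd (by omega) ((q_dvd d (not_lt.1 hlt)).trans h1)
          omega
        have hdt : q d k ∣ t := by
          have := q_dvd d hkK.le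
          rw [← hn] at this
          exact (Nat.dvd_add_right h1).1 this
        have := Nat.le_of_dvd h hdt
        rw [h3, ih (t - q d k) (by omega) (n + q d k) (by omega), mul_zero]
  funext n
  have h5 := (q_strictMono d hd0 hd).le_apply (x := N + n + 1)
  exact key (N + n + 1) (by omega) (q d (N + n + 1) - (n + 1)) n (by omega)

/-! ### The explicit left eigenvector -/

/-- The explicit left eigenvector. -/
def phi (d : ℕ → ℕ) (p : ℕ → ℝ) (lam : ℂ) (N n : ℕ) : ℂ :=
  ∏ j ∈ Finset.range N, (iota d p lam (j + 1))⁻¹ ^ digit d n (j + 1)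

lemma phi_zero (d : ℕ → ℕ) (p : ℕ → ℝ) (lam : ℂ) (N : ℕ) : phi d p lam N 0 = 1 := by
  simp [phi, digit]

lemma phi_bounded (d : ℕ → ℕ) (p : ℕ → ℝ) (hd : ∀ j, 1 ≤ j → 2 ≤ d j) (lam : ℂ) (N : ℕ) :
    ∃ C, ∀ n, ‖phi d p lam N n‖ ≤ C := by
  refine ⟨∏ j ∈ Finset.range N, ∑ a ∈ Finset.range (d (j + 1)), ‖(iota d p lam (j + 1))⁻¹‖ ^ a,
    fun n => ?_⟩
  unfold phi
  rw [norm_prod]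
  refine Finset.prod_le_prod (fun _ _ => norm_nonneg _) fun j _ => ?_
  rw [norm_pow]
  refine Finset.single_le_sum (f := fun a => ‖(iota d p lam (j + 1))⁻¹‖ ^ a)
    (fun _ _ => by positivity) ?_
  rw [Finset.mem_range]
  exact Nat.mod_lt _ (by have := hd (j + 1) (by omega); omega)

lemma digit_add (d : ℕ → ℕ) (hd0 : d 0 = 1) (hd : ∀ j, 1 ≤ j → 2 ≤ d j) (n k : ℕ)
    (h1 : q d k ∣ n + 1) (h2 : ¬ q d (k + 1) ∣ n + 1) (j : ℕ) :
    digit d (n + q d k) (j + 1) = digit d n (j + 1) + if j = k then 1 else 0 := by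
  have hq := q_pos d hd0 hd k
  have hdig := (q_dvd_succ_iff d hd0 hd n k h1).not.1 h2
  unfold digit at hdig ⊢
  simp only [Nat.add_sub_cancel] at hdig ⊢
  have hd' := hd (j + 1) (by omega)
  rcases lt_trichotomy j k with h | h | h
  · rw [if_neg h.ne]
    obtain ⟨c, hc⟩ := q_dvd d (show j + 1 ≤ k by omega)
    rw [hc, q_succ, mul_assoc, Nat.add_mul_div_left _ _ (q_pos d hd0 hd j), Nat.add_mul_mod_self_left,
      add_zero]
  · subst h
    rw [if_pos rfl, Nat.add_div_right _ hq]
    have := Nat.mod_lt (n / q d j) (show 0 < d (j + 1) by omega)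
    rw [Nat.add_mod, Nat.mod_eq_of_lt (a := 1) (by omega),
      Nat.mod_eq_of_lt (by omega)]
  · rw [if_neg h.ne', add_zero]
    congr 1
    obtain ⟨c, hc⟩ := q_dvd d (show k + 1 ≤ j by omega)
    rw [hc, q_succ, mul_assoc, ← Nat.div_div_eq_div_mul, ← Nat.div_div_eq_div_mul,
      ← Nat.div_div_eq_div_mul, ← Nat.div_div_eq_div_mul, Nat.add_div_right _ hq]
    congr 1
    have hdk := hd (k + 1) (by omega)
    have h3 := Nat.div_add_mod (n / q d k) (d (k + 1))
    have h4 := Nat.mod_lt (n / q d k) (show 0 < d (k + 1) by omega)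
    set u := n / q d k
    set e := d (k + 1)
    apply Nat.div_eq_of_lt_le
    · rw [mul_comm]; omega
    · rw [Nat.succ_mul, mul_comm]; omega

lemma phi_rel (d : ℕ → ℕ) (p : ℕ → ℝ)
    (hd0 : d 0 = 1) (hd : ∀ j, 1 ≤ j → 2 ≤ d j)
    (hp : ∀ j, 1 ≤ j → p j ∈ Set.Ioc (0 : ℝ) 1) (lam : ℂ) (N : ℕ) (hN : ftil d p N lam = 1)
    (hi : ∀ k, iota d p lam (k + 1) ≠ 0) (k : ℕ) :
    Rel d p lam (fun x => phi d p lam N (-x - 1).toNat) (fun x => x < 0) k := by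
  intro M hM hk hk'
  obtain ⟨n, rfl⟩ : ∃ n : ℕ, M = -((n + 1 : ℕ) : ℤ) := ⟨(-M - 1).toNat, by omega⟩
  rw [dvd_neg] at hk hk'
  have h1 := Int.natCast_dvd_natCast.1 hk
  have h2 : ¬ q d (k + 1) ∣ n + 1 := fun h => hk' (Int.natCast_dvd_natCast.2 h)
  have e1 : (- (-((n + 1 : ℕ) : ℤ)) - 1).toNat = n := by omega
  have e2 : (- (-((n + 1 : ℕ) : ℤ) - q d k) - 1).toNat = n + q d k := by omega
  simp only [e1, e2]
  unfold phi
  simp only [digit_add d hd0 hd n k h1 h2, pow_add, Finset.prod_mul_distrib]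
  have : ∏ j ∈ Finset.range N, (iota d p lam (j + 1))⁻¹ ^ (if j = k then 1 else 0)
      = (iota d p lam (k + 1))⁻¹ := by
    by_cases hkN : k < N
    · rw [Finset.prod_eq_single k]
      · simp
      · intro b _ hb; simp [hb]
      · intro h; simp at h; omega
    · rw [(ftil_one d p hp lam N hN k (by omega)).2, inv_one]
      apply Finset.prod_eq_one
      intro j hj
      rw [Finset.mem_range] at hj
      rw [if_neg (by omega), pow_zero]
  rw [this]
  field_simp [hi k]

lemma phi_eigen (d : ℕ → ℕ) (p : ℕ → ℝ)
    (hd0 : d 0 = 1) (hd : ∀ j, 1 ≤ j → 2 ≤ d j)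
    (hp : ∀ j, 1 ≤ j → p j ∈ Set.Ioc (0 : ℝ) 1) (lam : ℂ) (N : ℕ) (hN : ftil d p N lam = 1)
    (hi : ∀ k, iota d p lam (k + 1) ≠ 0)
    (hP : Tendsto (fun n => PP p n) atTop (𝓝 0)) (m : ℕ) (a : ℂ)
    (ha : HasSum (fun n => (s d p n m : ℂ) * phi d p lam N n) a) :
    a = lam * phi d p lam N m := by
  have hR := phi_rel d p hd0 hd hp lam N hN hi
  rcases Nat.eq_zero_or_pos m with h | h
  · subst h
    have hc := col_zero d p hd0 hd _ _ ha
    have ht := left_tele d p hd0 hd hp lam _ hR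
    obtain ⟨C, hC⟩ := phi_bounded d p hd lam N
    have h1 : Tendsto (fun k => (PP p k : ℂ) * phi d p lam N (q d k - 1)) atTop (𝓝 0) := by
      rw [tendsto_zero_iff_norm_tendsto_zero]
      refine squeeze_zero (g := fun k => PP p k * C) (fun _ => norm_nonneg _) (fun k => ?_) ?_
      · rw [norm_mul, Complex.norm_real, Real.norm_of_nonneg (PP_pos p hp k).le]
        exact mul_le_mul_of_nonneg_left (hC _) (PP_pos p hp k).le
      · simpa using hP.mul_const C
    have h2 : Tendsto (fun k => lam * phi d p lam N 0 - ∑ r ∈ Finset.range k,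
        (1 - (p (r + 1) : ℂ)) * PP p r * phi d p lam N (q d r - 1)) atTop (𝓝 0) := by
      refine h1.congr' ?_
      filter_upwards [eventually_ge_atTop N] with k hk
      rw [ht, (ftil_one d p hp lam N hN k hk).1, mul_one]
    have h3 := tendsto_nhds_unique ((tendsto_const_nhds (x := lam * phi d p lam N 0)).sub hc) h2
    exact (sub_eq_zero.1 h3).symm
  · obtain ⟨n, rfl⟩ : ∃ n, m = n + 1 := ⟨m - 1, by omega⟩
    obtain ⟨k, h1, h2⟩ := exists_level_nat d hd0 hd n
    have hk : (q d k : ℤ) ∣ -((n + 1 : ℕ) : ℤ) := by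
      rw [dvd_neg]; exact Int.natCast_dvd_natCast.2 h1
    have hk' : ¬ (q d (k + 1) : ℤ) ∣ -((n + 1 : ℕ) : ℤ) := by
      rw [dvd_neg]; exact fun h => h2 (Int.natCast_dvd_natCast.1 h)
    have h3 := (localEq_iff d p hd0 hd hp lam _ _ k (fun j _ => hR j) (-((n + 1 : ℕ) : ℤ)) hk
      (fun x _ hx => by omega)).2 (hR k _ (by omega) hk hk')
    rw [ha.unique (col_sum d p hd0 hd n k h1 h2 _)]
    unfold LocalEq at h3
    have e1 : (- (-((n + 1 : ℕ) : ℤ)) - 1).toNat = n := by omega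
    have e2 : (- (-((n + 1 : ℕ) : ℤ) - 1) - 1).toNat = n + 1 := by omega
    simp only [e1, e2] at h3
    rw [← h3]
    congr 1
    refine Finset.sum_congr rfl fun r _ => ?_
    congr 2
    omega

/-! ### Functional analysis -/

lemma exists_functional {M : Type*} [NormedAddCommGroup M] [NormedSpace ℂ M]
    (A : M →L[ℂ] M) (h : ¬ DenseRange A) : ∃ Φ : M →L[ℂ] ℂ, Φ ≠ 0 ∧ ∀ x, Φ (A x) = 0 := by
  set K : Submodule ℂ M := (LinearMap.range (A : M →ₗ[ℂ] M)).topologicalClosure with hK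
  have hcl : IsClosed (K : Set M) := Submodule.isClosed_topologicalClosure _
  have hne : ∃ x, x ∉ K := by
    by_contra! hall
    apply h
    intro x
    have := hall x
    rw [hK, ← SetLike.mem_coe, Submodule.topologicalClosure_coe] at this
    exact this
  obtain ⟨x, hx⟩ := hne
  have hx' : ‖(K.mkQ x : M ⧸ K)‖ ≠ 0 := by
    rw [norm_ne_zero_iff]
    simpa using hx
  obtain ⟨g, _, hg⟩ := exists_dual_vector ℂ (K.mkQ x : M ⧸ K) hx'
  refine ⟨g.comp K.mkQL, ?_, ?_⟩
  · intro h0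
    have h1 := DFunLike.congr_fun h0 x
    have h2 : g (K.mkQ x) = 0 := h1
    rw [hg] at h2
    exact hx' (RCLike.ofReal_eq_zero.1 h2)
  · intro y
    have hy : K.mkQ (A y) = 0 := by
      rw [Submodule.mkQ_apply, Submodule.Quotient.mk_eq_zero]
      exact Submodule.le_topologicalClosure _ ⟨y, rfl⟩
    change g (K.mkQ (A y)) = 0
    rw [hy, map_zero]

lemma summable_lp_one (w : lp (fun _ : ℕ => ℂ) 1) : HasSum (fun n => ‖w n‖) ‖w‖ := by
  have := lp.hasSum_norm (p := 1) (by simp) w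
  simpa using this

/-- The functional on `l¹` attached to a bounded sequence. -/
lemma exists_pairing (φ : ℕ → ℂ) (C : ℝ) (hC : ∀ n, ‖φ n‖ ≤ C) :
    ∃ Φ : lp (fun _ : ℕ => ℂ) 1 →L[ℂ] ℂ, ∀ w, HasSum (fun n => w n * φ n) (Φ w) := by
  have hs : ∀ w : lp (fun _ : ℕ => ℂ) 1, Summable fun n => ‖w n * φ n‖ := by
    intro w
    refine Summable.of_nonneg_of_le (fun _ => norm_nonneg _) (fun n => ?_)
      ((summable_lp_one w).summable.mul_right C)
    rw [norm_mul]
    exact mul_le_mul_of_nonneg_left (hC n) (norm_nonneg _)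
  have hs' : ∀ w : lp (fun _ : ℕ => ℂ) 1, Summable fun n => w n * φ n := fun w => (hs w).of_norm
  let Φ : lp (fun _ : ℕ => ℂ) 1 →ₗ[ℂ] ℂ :=
    { toFun := fun w => ∑' n, w n * φ n
      map_add' := by
        intro x y
        rw [← (hs' x).tsum_add (hs' y)]
        refine tsum_congr fun n => ?_
        simp [add_mul]
      map_smul' := by
        intro c x
        rw [RingHom.id_apply, smul_eq_mul, ← tsum_mul_left]
        refine tsum_congr fun n => ?_
        simp [mul_assoc] }
  refine ⟨Φ.mkContinuous C fun w => ?_, fun w => (hs' w).hasSum⟩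
  have h1 : ‖Φ w‖ ≤ ∑' n, ‖w n * φ n‖ := norm_tsum_le_tsum_norm (hs w)
  refine h1.trans ?_
  rw [mul_comm C, ← (summable_lp_one w).tsum_eq, ← tsum_mul_right]
  refine (hs w).tsum_le_tsum (fun n => ?_) ((summable_lp_one w).summable.mul_right C)
  rw [norm_mul]
  exact mul_le_mul_of_nonneg_left (hC n) (norm_nonneg _)

lemma hasSum_functional (Φ : lp (fun _ : ℕ => ℂ) 1 →L[ℂ] ℂ) (w : lp (fun _ : ℕ => ℂ) 1) :
    HasSum (fun n => w n * Φ (lp.single 1 n (1 : ℂ))) (Φ w) := by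
  have h := (lp.hasSum_single (p := 1) (by simp) w).mapL Φ
  refine h.congr_fun ?_ |> id
  intro n
  have : lp.single (E := fun _ : ℕ => ℂ) 1 n (w n) = w n • lp.single 1 n (1 : ℂ) := by
    rw [← lp.single_smul]; simp
  rw [this, map_smul, smul_eq_mul]

lemma T_single (d : ℕ → ℕ) (p : ℕ → ℝ)
    (T1 : lp (fun _ : ℕ => ℂ) 1 →L[ℂ] lp (fun _ : ℕ => ℂ) 1)
    (hT1 : ∀ (w : lp (fun _ : ℕ => ℂ) 1) (n : ℕ),
      T1 w n = ∑' m : ℕ, (s d p n m : ℂ) * w m) (m n : ℕ) :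
    T1 (lp.single 1 m (1 : ℂ)) n = s d p n m := by
  rw [hT1, tsum_eq_single m]
  · simp
  · intro b hb
    rw [lp.single_apply_ne _ _ _ hb, mul_zero]

lemma T_injective (d : ℕ → ℕ) (p : ℕ → ℝ)
    (hd0 : d 0 = 1) (hd : ∀ j, 1 ≤ j → 2 ≤ d j)
    (hp : ∀ j, 1 ≤ j → p j ∈ Set.Ioc (0 : ℝ) 1)
    (T1 : lp (fun _ : ℕ => ℂ) 1 →L[ℂ] lp (fun _ : ℕ => ℂ) 1)
    (hT1 : ∀ (w : lp (fun _ : ℕ => ℂ) 1) (n : ℕ),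
      T1 w n = ∑' m : ℕ, (s d p n m : ℂ) * w m)
    (lam : ℂ) (N : ℕ) (hN : ftil d p N lam = 1) :
    Function.Injective ⇑(T1 - lam • (1 : lp (fun _ : ℕ => ℂ) 1 →L[ℂ] lp (fun _ : ℕ => ℂ) 1)) := by
  rw [injective_iff_map_eq_zero]
  intro w hw
  have hw' : T1 w = lam • w := by
    simpa [sub_eq_zero] using hw
  have h0 := eigen_zero d p hd0 hd hp lam N hN (fun n => w n)
    (tendsto_zero_iff_norm_tendsto_zero.2 (summable_lp_one w).summable.tendsto_atTop_zero)
    (fun n => by rw [← hT1, hw']; simp)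
  apply lp.ext
  exact h0

/-- with `X = ⋃_{n≥1} ftil_n⁻¹ {1} \\ ⋃_{n≥1} ftil_n⁻¹ {0}`:
if `Π p_j = 0` then `X ⊆ σ_r(S on l¹)`; if `Π p_j > 0` then `σ_r(S on l¹)` is
disjoint from `⋃_{n≥1} ftil_n⁻¹ {1}`. -/
theorem stmt18 (d : ℕ → ℕ) (p : ℕ → ℝ)
    (hd0 : d 0 = 1) (hd : ∀ j, 1 ≤ j → 2 ≤ d j)
    (hp : ∀ j, 1 ≤ j → p j ∈ Set.Ioc (0 : ℝ) 1)
    (T1 : lp (fun _ : ℕ => ℂ) 1 →L[ℂ] lp (fun _ : ℕ => ℂ) 1)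
    (hT1 : ∀ (w : lp (fun _ : ℕ => ℂ) 1) (n : ℕ),
      T1 w n = ∑' m : ℕ, (s d p n m : ℂ) * w m) :
    (Filter.Tendsto (fun n => ∏ j ∈ Finset.Icc 1 n, p j) Filter.atTop (nhds (0 : ℝ)) →
      (⋃ n : ℕ, ftil d p (n + 1) ⁻¹' {(1 : ℂ)}) \ (⋃ n : ℕ, ftil d p (n + 1) ⁻¹' {(0 : ℂ)})
        ⊆ residualSpectrum T1) ∧
      ((∃ L : ℝ, 0 < L ∧
          Filter.Tendsto (fun n => ∏ j ∈ Finset.Icc 1 n, p j) Filter.atTop (nhds L)) →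
        residualSpectrum T1 ∩ (⋃ n : ℕ, ftil d p (n + 1) ⁻¹' {(1 : ℂ)}) = ∅) := by
  constructor
  · rintro hP lam ⟨h1, h2⟩
    simp only [Set.mem_iUnion, Set.mem_preimage, Set.mem_singleton_iff, not_exists] at h1 h2
    obtain ⟨n, hN⟩ := h1
    refine ⟨T_injective d p hd0 hd hp T1 hT1 lam (n + 1) hN, fun hdense => ?_⟩
    have hi : ∀ k, iota d p lam (k + 1) ≠ 0 := by
      intro k hk
      apply h2 k
      rw [ftil_succ_iota, hk, zero_pow]
      have := hd (k + 1) (by omega)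
      omega
    obtain ⟨C, hC⟩ := phi_bounded d p hd lam (n + 1)
    obtain ⟨Φ, hΦ⟩ := exists_pairing (phi d p lam (n + 1)) C hC
    have hsingle : ∀ m, Φ (lp.single 1 m (1 : ℂ)) = phi d p lam (n + 1) m := by
      intro m
      refine (hΦ _).unique ?_
      have : phi d p lam (n + 1) m
          = (lp.single (E := fun _ : ℕ => ℂ) 1 m (1 : ℂ)) m * phi d p lam (n + 1) m := by simp
      rw [this]
      refine hasSum_single m fun b hb => ?_
      rw [lp.single_apply_ne _ _ _ hb, zero_mul]
    have hcol : ∀ m, Φ (T1 (lp.single 1 m (1 : ℂ))) = lam * phi d p lam (n + 1) m := by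
      intro m
      refine phi_eigen d p hd0 hd hp lam (n + 1) hN hi hP m _ ?_
      have h := hΦ (T1 (lp.single 1 m (1 : ℂ)))
      simpa only [T_single d p T1 hT1] using h
    have hall : ∀ w, Φ ((T1 - lam • (1 : lp (fun _ : ℕ => ℂ) 1 →L[ℂ] lp (fun _ : ℕ => ℂ) 1)) w)
        = 0 := by
      intro w
      have h := hasSum_functional (Φ.comp
        (T1 - lam • (1 : lp (fun _ : ℕ => ℂ) 1 →L[ℂ] lp (fun _ : ℕ => ℂ) 1))) w
      refine h.unique ?_
      have hz : ∀ m, (Φ.comp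
        (T1 - lam • (1 : lp (fun _ : ℕ => ℂ) 1 →L[ℂ] lp (fun _ : ℕ => ℂ) 1)))
          (lp.single 1 m (1 : ℂ)) = 0 := by
        intro m
        have e : (Φ.comp
          (T1 - lam • (1 : lp (fun _ : ℕ => ℂ) 1 →L[ℂ] lp (fun _ : ℕ => ℂ) 1)))
          (lp.single 1 m (1 : ℂ))
          = Φ (T1 (lp.single 1 m (1 : ℂ))) - lam * Φ (lp.single 1 m (1 : ℂ)) := by
          simp
        rw [e, hcol, hsingle, sub_self]
      simp only [hz, mul_zero]
      exact hasSum_zero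
    have hzero : (Φ : lp (fun _ : ℕ => ℂ) 1 → ℂ) = fun _ => 0 :=
      hdense.equalizer Φ.continuous continuous_const (funext hall)
    have h0 := congrFun hzero (lp.single 1 0 (1 : ℂ))
    rw [hsingle, phi_zero] at h0
    exact one_ne_zero h0
  · rintro ⟨L, hL, hP⟩
    rw [Set.eq_empty_iff_forall_notMem]
    rintro lam ⟨⟨_, hnd⟩, h1⟩
    simp only [Set.mem_iUnion, Set.mem_preimage, Set.mem_singleton_iff] at h1
    obtain ⟨n, hN⟩ := h1
    obtain ⟨Φ, hΦ0, hΦ⟩ := exists_functional _ hnd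
    have hTΦ : ∀ w, Φ (T1 w) = lam * Φ w := by
      intro w
      have h := hΦ w
      simpa [sub_eq_zero] using h
    have hz := left_zero d p hd0 hd hp lam (n + 1) hN L hL hP
      (fun m => Φ (lp.single 1 m (1 : ℂ))) (by
        intro m
        have h := hasSum_functional Φ (T1 (lp.single 1 m (1 : ℂ)))
        rw [hTΦ] at h
        simpa only [T_single d p T1 hT1] using h)
    apply hΦ0
    ext w
    have h := hasSum_functional Φ w
    have hz' : ∀ m, Φ (lp.single 1 m (1 : ℂ)) = 0 := fun m => congrFun hz m
    simp only [hz', mul_zero] at h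
    exact h.unique hasSum_zero

end AMFC
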